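/- arXiv:1311.7476 — 2 statements merged into one kernel-verified Lean document; each statement's English description precedes it below -/
import Mathlib

section
/- In the ring of formal power series in q whose coefficients are Laurent polynomials in t over ℤ, one has the identity ∑_{k ∈ ℤ} (−1)^k q^{k(k+1)/2} t^k = ∏_{m≥1}(1 − q^m) · (1 − t^{−1}) · ∏_{m≥1}(1 − q^m t)(1 − q^m t^{−1}). More precisely, for every integer N ≥ 0, the coefficient of q^N on the left-hand side (a finite sum, since k(k+1)/2 = N has finitely many integer solutions k) equals the coefficient of q^N in the product ∏_{m=1}^{N}(1 − q^m) · (1 − t^{−1}) · ∏_{m=1}^{N}(1 − q^m t)(1 − q^m t^{−1}), as Laurent polynomials in t. -/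
open Polynomial

section GaussianBinomial

variable {R : Type*} [CommRing R]

/-- The Gaussian binomial coefficient, evaluated at an element `q` of a commutative ring. -/
def gaussianBinomial (q : R) : ℕ → ℕ → R
  | _, 0 => 1
  | 0, _ + 1 => 0
  | n + 1, k + 1 => gaussianBinomial q n k + q ^ (k + 1) * gaussianBinomial q n (k + 1)

theorem gaussianBinomial_zero_right (q : R) (n : ℕ) : gaussianBinomial q n 0 = 1 := by
  cases n <;> rfl

theorem gaussianBinomial_succ_succ (q : R) (n k : ℕ) :
    gaussianBinomial q (n + 1) (k + 1) =
      gaussianBinomial q n k + q ^ (k + 1) * gaussianBinomial q n (k + 1) := rfl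

theorem gaussianBinomial_eq_zero_of_lt (q : R) {n k : ℕ} (h : n < k) :
    gaussianBinomial q n k = 0 := by
  induction n generalizing k with
  | zero => obtain ⟨k, rfl⟩ := Nat.exists_eq_succ_of_ne_zero h.ne'; rfl
  | succ n ih =>
    obtain ⟨k, rfl⟩ := Nat.exists_eq_succ_of_ne_zero (Nat.ne_zero_of_lt h)
    rw [Nat.succ_eq_add_one, gaussianBinomial_succ_succ, ih (by omega), ih (by omega)]
    ring

theorem gaussianBinomial_self (q : R) (n : ℕ) : gaussianBinomial q n n = 1 := by
  induction n with
  | zero => rfl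
  | succ n ih =>
    rw [gaussianBinomial_succ_succ, ih, gaussianBinomial_eq_zero_of_lt q n.lt_succ_self]
    ring

/-- The second Pascal rule for Gaussian binomial coefficients. -/
theorem gaussianBinomial_add_succ_succ (q : R) (k l : ℕ) :
    gaussianBinomial q (k + l + 1) (k + 1) =
      q ^ l * gaussianBinomial q (k + l) k + gaussianBinomial q (k + l) (k + 1) := by
  induction l generalizing k with
  | zero =>
    simp [gaussianBinomial_self, gaussianBinomial_eq_zero_of_lt]
  | succ l ihl =>
    induction k with
    | zero =>
      have h := ihl 0
      rw [← add_assoc, gaussianBinomial_succ_succ]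
      simp only [zero_add, gaussianBinomial_zero_right] at h ⊢
      have h₂ := gaussianBinomial_succ_succ q l 0
      simp only [zero_add, gaussianBinomial_zero_right] at h₂
      linear_combination q * h - h₂
    | succ k ihk =>
      have h₁ := ihl (k + 1)
      have e₁ : k + 1 + l = k + (l + 1) := by ring
      have e₂ : k + 1 + (l + 1) = k + (l + 1) + 1 := by ring
      have h₂ := gaussianBinomial_succ_succ q (k + (l + 1)) k
      have h₃ := gaussianBinomial_succ_succ q (k + (l + 1)) (k + 1)
      rw [e₁] at h₁
      rw [e₂, gaussianBinomial_succ_succ]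
      linear_combination ihk + q ^ (k + 2) * h₁ - q ^ (l + 1) * h₂ - h₃

/-- The finite `q`-Pochhammer product `(1 - q) (1 - q²) ⋯ (1 - qⁿ)`. -/
def qFactorial (q : R) (n : ℕ) : R := ∏ m ∈ Finset.Icc 1 n, (1 - q ^ m)

theorem qFactorial_succ (q : R) (n : ℕ) :
    qFactorial q (n + 1) = qFactorial q n * (1 - q ^ (n + 1)) :=
  Finset.prod_Icc_succ_top (by omega) _

theorem qFactorial_mul_qFactorial_mul_gaussianBinomial (q : R) (k l : ℕ) :
    qFactorial q k * qFactorial q l * gaussianBinomial q (k + l) k = qFactorial q (k + l) := by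
  induction k generalizing l with
  | zero => simp [qFactorial, gaussianBinomial_zero_right]
  | succ k ihk =>
    induction l with
    | zero => simp [qFactorial, gaussianBinomial_self]
    | succ l ihl =>
      have h := ihk (l + 1)
      have e₁ : k + 1 + l = k + (l + 1) := by ring
      have e₂ : k + 1 + (l + 1) = k + (l + 1) + 1 := by ring
      rw [e₁] at ihl
      rw [e₂, gaussianBinomial_succ_succ, qFactorial_succ q (k + (l + 1))]
      rw [qFactorial_succ q k] at ihl ⊢
      rw [qFactorial_succ q l] at h ⊢
      linear_combination (1 - q ^ (k + 1)) * h + q ^ (k + 1) * (1 - q ^ (l + 1)) * ihl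

theorem pow_dvd_qFactorial_add_sub (q : R) (n k : ℕ) :
    q ^ (n + 1) ∣ qFactorial q (n + k) - qFactorial q n := by
  induction k with
  | zero => simp
  | succ k ih =>
    rw [← add_assoc, qFactorial_succ, show n + k + 1 = n + 1 + k by ring]
    convert dvd_sub ih (dvd_mul_right (q ^ (n + 1)) (q ^ k * qFactorial q (n + k))) using 1
    ring

theorem isCoprime_pow_qFactorial (q : R) (a n : ℕ) : IsCoprime (q ^ a) (qFactorial q n) := by
  refine IsCoprime.pow_left (IsCoprime.prod_right fun m hm ↦ ?_)
  obtain ⟨m, rfl⟩ := Nat.exists_eq_succ_of_ne_zero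
    (Nat.one_le_iff_ne_zero.1 (Finset.mem_Icc.1 hm).1)
  exact ⟨q ^ m, 1, by rw [Nat.succ_eq_add_one]; ring⟩

theorem pow_dvd_qFactorial_mul_gaussianBinomial_sub_one (q : R) {k l d n : ℕ}
    (hk : d ≤ k) (hl : d ≤ l) (hn : d ≤ n) :
    q ^ (d + 1) ∣ qFactorial q n * gaussianBinomial q (k + l) k - 1 := by
  have key : ∀ m, d ≤ m → q ^ (d + 1) ∣ qFactorial q m - qFactorial q d := by
    intro m hm
    obtain ⟨c, rfl⟩ := Nat.exists_eq_add_of_le hm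
    exact pow_dvd_qFactorial_add_sub q d c
  refine (isCoprime_pow_qFactorial q (d + 1) d).dvd_of_dvd_mul_left ?_
  obtain ⟨a, ha⟩ := key k hk
  obtain ⟨b, hb⟩ := key l hl
  obtain ⟨c, hc⟩ := key n hn
  obtain ⟨e, he⟩ := key (k + l) (by omega)
  have h := qFactorial_mul_qFactorial_mul_gaussianBinomial q k l
  rw [sub_eq_iff_eq_add] at ha hb hc he
  rw [ha, hb, he] at h
  rw [hc]
  set G := gaussianBinomial q (k + l) k
  set Q := qFactorial q d
  refine ⟨Q * c * G + e - a * q ^ (d + 1) * b * G - a * Q * G - b * Q * G, ?_⟩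
  linear_combination h

/-- The exponent `k (k + 1) / 2` of `q` in the Jacobi theta series. -/
def thetaExponent (k : ℤ) : ℕ := (k * (k + 1) / 2).toNat

theorem two_mul_thetaExponent (k : ℤ) : 2 * (thetaExponent k : ℤ) = k * (k + 1) := by
  have h : 0 ≤ k * (k + 1) := by
    rcases le_or_gt 0 k with hk | hk <;> nlinarith
  rw [thetaExponent, Int.toNat_of_nonneg (by omega),
    Int.mul_ediv_cancel' (Int.even_mul_succ_self k).two_dvd]

theorem prod_one_sub_pow_mul (q t : R) (a : ℕ) :
    ∏ m ∈ Finset.Icc 1 a, (1 - q ^ m * t) =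
      ∑ j ∈ Finset.range (a + 1),
        (-1) ^ j * q ^ thetaExponent j * t ^ j * gaussianBinomial q a j := by
  induction a with
  | zero => simp [thetaExponent, gaussianBinomial_zero_right]
  | succ a ih =>
    rw [Finset.prod_Icc_succ_top (by omega), ih, mul_sub, mul_one, Finset.sum_range_succ' _ (a + 1)]
    have h : ∀ j ∈ Finset.range (a + 1),
        (-1 : R) ^ (j + 1) * q ^ thetaExponent ((j + 1 : ℕ) : ℤ) * t ^ (j + 1) *
          gaussianBinomial q (a + 1) (j + 1) =
        (-1) ^ (j + 1) * q ^ thetaExponent ((j + 1 : ℕ) : ℤ) * t ^ (j + 1) *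
          gaussianBinomial q a (j + 1) -
        (-1) ^ j * q ^ thetaExponent j * t ^ j * gaussianBinomial q a j * (q ^ (a + 1) * t) := by
      intro j hj
      obtain ⟨l, rfl⟩ := Nat.exists_eq_add_of_le (Finset.mem_range_succ_iff.1 hj)
      have he : thetaExponent ((j + 1 : ℕ) : ℤ) = thetaExponent j + (j + 1) := by
        have h₁ := two_mul_thetaExponent ((j + 1 : ℕ) : ℤ)
        have h₂ := two_mul_thetaExponent j
        zify
        push_cast at h₁ ⊢
        linarith
      rw [gaussianBinomial_add_succ_succ, he]
      ring
    rw [Finset.sum_congr rfl h, Finset.sum_sub_distrib, ← Finset.sum_mul]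
    have h' := Finset.sum_range_succ' (fun j : ℕ ↦
      (-1 : R) ^ j * q ^ thetaExponent j * t ^ j * gaussianBinomial q a j) (a + 1)
    rw [Finset.sum_range_succ, gaussianBinomial_eq_zero_of_lt q a.lt_succ_self] at h'
    simp only [gaussianBinomial_zero_right] at h' ⊢
    linear_combination h'

/-- A finite form of the Jacobi triple product. -/
theorem prod_one_sub_pow_mul_mul_prod_sub_pow (q t : R) (a b : ℕ) :
    (∏ m ∈ Finset.Icc 1 a, (1 - q ^ m * t)) * ∏ m ∈ Finset.range b, (t - q ^ m) =
      ∑ j ∈ Finset.range (a + b + 1),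
        (-1) ^ (j + b) * q ^ thetaExponent (j - b) * t ^ j * gaussianBinomial q (a + b) j := by
  induction b with
  | zero => simpa using prod_one_sub_pow_mul q t a
  | succ b ih =>
    rw [Finset.prod_range_succ, ← mul_assoc, ih, mul_sub, ← add_assoc a b 1,
      Finset.sum_range_succ' _ (a + b + 1)]
    have he (j : ℕ) : thetaExponent ((j : ℤ) - b) + b =
        thetaExponent ((j : ℤ) - (b + 1 : ℕ)) + j := by
      have h₁ := two_mul_thetaExponent ((j : ℤ) - b)
      have h₂ := two_mul_thetaExponent ((j : ℤ) - (b + 1 : ℕ))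
      zify
      push_cast at h₂ ⊢
      linarith
    have hs (j : ℕ) : ((j + 1 : ℕ) : ℤ) - (b + 1 : ℕ) = j - b := by push_cast; ring
    have h (j : ℕ) :
        (-1 : R) ^ (j + 1 + (b + 1)) * q ^ thetaExponent (((j + 1 : ℕ) : ℤ) - (b + 1 : ℕ)) *
          t ^ (j + 1) * gaussianBinomial q (a + b + 1) (j + 1) =
        (-1) ^ (j + b) * q ^ thetaExponent (j - b) * t ^ j * gaussianBinomial q (a + b) j * t -
        (-1) ^ (j + 1 + b) * q ^ thetaExponent ((j + 1 : ℕ) - b) * t ^ (j + 1) *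
          gaussianBinomial q (a + b) (j + 1) * q ^ b := by
      have e := congrArg (q ^ ·) (he (j + 1))
      simp only [pow_add q, hs] at e
      rw [gaussianBinomial_succ_succ, hs]
      linear_combination
        (-1 : R) ^ (j + 1 + b) * t ^ (j + 1) * gaussianBinomial q (a + b) (j + 1) * e
    rw [Finset.sum_congr rfl fun j _ ↦ h j, Finset.sum_sub_distrib, ← Finset.sum_mul,
      ← Finset.sum_mul]
    have h' := Finset.sum_range_succ' (fun j : ℕ ↦
      (-1 : R) ^ (j + b) * q ^ thetaExponent (j - b) * t ^ j * gaussianBinomial q (a + b) j)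
      (a + b + 1)
    rw [Finset.sum_range_succ, gaussianBinomial_eq_zero_of_lt q (a + b).lt_succ_self] at h'
    have e := congrArg (q ^ ·) (he 0)
    simp only [pow_add q] at e
    simp only [gaussianBinomial_zero_right] at h' ⊢
    linear_combination -q ^ b * h' - (-1 : R) ^ b * e

/-- The Jacobi triple product truncated at `N`, in terms of Gaussian binomial coefficients. -/
theorem jacobi_prod_eq_sum_gaussianBinomial (q t s : R) (hts : t * s = 1) (N : ℕ) :
    (∏ m ∈ Finset.Icc 1 N, (1 - q ^ m)) * (1 - s) *
        ∏ m ∈ Finset.Icc 1 N, ((1 - q ^ m * t) * (1 - q ^ m * s)) =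
      ∑ j ∈ Finset.range (2 * N + 2), qFactorial q N *
        ((-1) ^ (j + (N + 1)) * (t ^ j * s ^ (N + 1)) * q ^ thetaExponent (j - (N + 1 : ℕ)) *
          gaussianBinomial q (2 * N + 1) j) := by
  have hprod : (1 - s) * ∏ m ∈ Finset.Icc 1 N, (1 - q ^ m * s) =
      s ^ (N + 1) * ∏ m ∈ Finset.range (N + 1), (t - q ^ m) := by
    rw [← Finset.card_range (N + 1), ← Finset.prod_const, Finset.card_range,
      ← Finset.prod_mul_distrib, Finset.prod_range_succ', mul_comm (1 - _),
      Finset.range_eq_Ico, Finset.prod_Ico_add' (fun m ↦ s * (t - q ^ m)) 0 N 1]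
    congr 1
    · exact Finset.prod_congr rfl fun m _ ↦ by linear_combination -hts
    · linear_combination -hts
  have hmain := prod_one_sub_pow_mul_mul_prod_sub_pow q t N (N + 1)
  rw [show N + (N + 1) = 2 * N + 1 by ring] at hmain
  rw [Finset.prod_mul_distrib, ← Finset.mul_sum]
  trans qFactorial q N * (s ^ (N + 1) * ((∏ m ∈ Finset.Icc 1 N, (1 - q ^ m * t)) *
    ∏ m ∈ Finset.range (N + 1), (t - q ^ m)))
  · rw [qFactorial]
    linear_combination (∏ m ∈ Finset.Icc 1 N, (1 - q ^ m)) *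
      (∏ m ∈ Finset.Icc 1 N, (1 - q ^ m * t)) * hprod
  · rw [hmain, Finset.mul_sum]
    exact congrArg _ (Finset.sum_congr rfl fun j _ ↦ by ring)

end GaussianBinomial

/-- Up to degree `N`, the finite product `(1 - X) ⋯ (1 - X ^ N)` cancels the Gaussian binomial
coefficients in the truncated triple product. -/
theorem coeff_qFactorial_mul_thetaTerm (A : Type*) [CommRing A] (N j : ℕ) (hj : j < 2 * N + 2)
    (c : A) :
    (qFactorial (X : A[X]) N * (C c * X ^ thetaExponent (j - (N + 1 : ℕ)) *
      gaussianBinomial X (2 * N + 1) j)).coeff N =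
      if thetaExponent (j - (N + 1 : ℕ)) = N then c else 0 := by
  obtain ⟨l, hl⟩ : ∃ l, 2 * N + 1 = j + l := ⟨2 * N + 1 - j, by omega⟩
  have hd := pow_dvd_qFactorial_mul_gaussianBinomial_sub_one (X : A[X])
    (k := j) (l := l) (d := min j l) (n := N) (by omega) (by omega) (by omega)
  have he : N < thetaExponent (j - (N + 1 : ℕ)) + (min j l + 1) := by
    have h := two_mul_thetaExponent (j - (N + 1 : ℕ))
    rcases le_total j l with hjl | hjl
    · rw [min_eq_left hjl]
      zify
      push_cast at h
      nlinarith [sq_nonneg ((j : ℤ) - (N + 1)), sq_nonneg ((j : ℤ) - N)]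
    · rw [min_eq_right hjl]
      zify
      have : (l : ℤ) = 2 * N + 1 - j := by omega
      push_cast at h
      nlinarith [sq_nonneg ((j : ℤ) - (N + 1)), sq_nonneg ((j : ℤ) - N)]
  rw [← hl] at hd
  obtain ⟨r, hr⟩ := hd
  rw [show qFactorial (X : A[X]) N * (C c * X ^ thetaExponent (j - (N + 1 : ℕ)) *
      gaussianBinomial X (2 * N + 1) j) = C c * X ^ thetaExponent (j - (N + 1 : ℕ)) +
      C c * r * X ^ (thetaExponent (j - (N + 1 : ℕ)) + (min j l + 1)) by
    rw [pow_add]; linear_combination C c * X ^ thetaExponent (j - (N + 1 : ℕ)) * hr]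
  rw [coeff_add, coeff_C_mul_X_pow, coeff_mul_X_pow', if_neg he.not_ge, add_zero]
  simp only [eq_comm]

/-- **Formal Jacobi triple product.**  In `ℤ[t,t⁻¹][[q]]`, one has
`∑_{k∈ℤ} (−1)^k q^{k(k+1)/2} t^k
  = ∏_{m≥1}(1 − q^m) · (1 − t⁻¹) · ∏_{m≥1}(1 − q^m t)(1 − q^m t⁻¹)`:
for every `N ≥ 0`, the (finite) sum of `(−1)^k t^k` over the integers `k` with
`k(k+1)/2 = N` equals the coefficient of `q^N` in
`∏_{m=1}^{N}(1 − q^m) · (1 − t⁻¹) · ∏_{m=1}^{N}(1 − q^m t)(1 − q^m t⁻¹)`,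
as Laurent polynomials in `t`.  Here `q` is the polynomial variable `X` of
`Polynomial (LaurentPolynomial ℤ)` and `t^k` is `LaurentPolynomial.T k`. -/
theorem formal_jacobi_triple_product (N : ℕ) :
    (∑ᶠ k : ℤ, if k * (k + 1) = 2 * (N : ℤ) then
        ((((-1 : ℤˣ) ^ k : ℤˣ) : ℤ) : LaurentPolynomial ℤ) * LaurentPolynomial.T k
      else 0) =
    Polynomial.coeff
      ((∏ m ∈ Finset.Icc 1 N, (1 - (Polynomial.X : Polynomial (LaurentPolynomial ℤ)) ^ m)) *
        (1 - Polynomial.C (LaurentPolynomial.T (-1))) *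
        ∏ m ∈ Finset.Icc 1 N,
          ((1 - Polynomial.X ^ m * Polynomial.C (LaurentPolynomial.T 1)) *
            (1 - Polynomial.X ^ m * Polynomial.C (LaurentPolynomial.T (-1))))) N := by
  have hT : (C (LaurentPolynomial.T 1 : LaurentPolynomial ℤ)) *
      C (LaurentPolynomial.T (-1)) = 1 := by
    rw [← C_mul, ← LaurentPolynomial.T_add]; simp
  have hC (j : ℕ) : (-1) ^ (j + (N + 1)) * (C (LaurentPolynomial.T 1) ^ j *
      C (LaurentPolynomial.T (-1)) ^ (N + 1)) =
      C ((-1 : LaurentPolynomial ℤ) ^ (j + (N + 1)) *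
        LaurentPolynomial.T ((j : ℤ) - (N + 1 : ℕ))) := by
    rw [sub_eq_add_neg (j : ℤ), LaurentPolynomial.T_add, ← C_pow, ← C_pow,
      LaurentPolynomial.T_pow, LaurentPolynomial.T_pow, mul_one, mul_neg_one, C_mul, C_mul,
      C_pow, C_neg, C_1]
  rw [jacobi_prod_eq_sum_gaussianBinomial _ _ _ hT, finsetSum_coeff,
    Finset.sum_congr rfl fun j hj ↦ by
      rw [hC, coeff_qFactorial_mul_thetaTerm _ N j (Finset.mem_range.1 hj)]]
  have hinj : Function.Injective fun j : ℕ ↦ (j : ℤ) - (N + 1 : ℕ) := fun i j h ↦ by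
    simpa using h
  rw [finsum_eq_sum_of_support_subset (s := (Finset.range (2 * N + 2)).map ⟨_, hinj⟩),
    Finset.sum_map]
  · refine Finset.sum_congr rfl fun j _ ↦ ?_
    have h := two_mul_thetaExponent (j - (N + 1 : ℕ))
    simp only [Function.Embedding.coeFn_mk]
    rw [← h]
    have hsign : ((((-1 : ℤˣ) ^ ((j : ℤ) - (N + 1 : ℕ)) : ℤˣ) : ℤ) : LaurentPolynomial ℤ) =
        (-1) ^ (j + (N + 1)) := by
      rw [zpow_sub, zpow_natCast, zpow_natCast, Int.units_inv_eq_self, ← pow_add]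
      simp
    rw [hsign]
    congr 1
    simp
  · intro k hk
    have hk' : k * (k + 1) = 2 * (N : ℤ) := by
      by_contra h
      simp [h] at hk
    have h₁ : k ≤ N := by by_contra! h; nlinarith
    have h₂ : -(N + 1 : ℤ) ≤ k := by by_contra! h; nlinarith
    simp only [Finset.coe_map, Set.mem_image, Finset.mem_coe, Finset.mem_range,
      Function.Embedding.coeFn_mk]
    exact ⟨(k + (N + 1)).toNat, by omega, by omega⟩
end

section
/- Let n ≥ 1 be an integer, τ ∈ ℂ with Im τ > 0, and z ∈ ℂ. Set q = e^{2πiτ}, t = e^{2πiz}, and fₙ(x) = 1 + x + ⋯ + xⁿ. Then η(τ)ⁿ · exp(πinτ/6) · exp(πinz) · ∏_{m≥1} fₙ(exp(2πi(mτ + z))) · ∏_{m≥0} fₙ(exp(2πi(mτ − z))) = ∏_{j=1}^{n} ( −ϑ₁₁(τ, z + j/(n+1)) ), where the two infinite products on the left converge (are multipliable). (This is the identity { q^{n/12} t^{n/2} ∏_{m>0} fₙ(q^m t) ∏_{m≥0} fₙ(q^m t^{−1}) } = ∏_{j=1}^{n} { −η(q)^{−1} ϑ_{1,1}(q, ξ^j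 t) } with ξ = e^{2πi/(n+1)}, asserted in the Remark on the width-n Euler characteristic flop formula, cleared of the denominator η(τ)ⁿ.) -/
open Complex

/-- The Jacobi theta function `ϑ₁₁(τ,z) = ∑_{k∈ℤ} q^{(k+1/2)²/2} (−t)^{k+1/2}`,
with `q = e^{2πiτ}`, `t = e^{2πiz}`. -/
noncomputable def theta11 (τ z : ℂ) : ℂ :=
  ∑' k : ℤ, Complex.exp (Real.pi * Complex.I * τ * (k + 1 / 2) ^ 2 +
    2 * Real.pi * Complex.I * (z + 1 / 2) * (k + 1 / 2))

/-- The Dedekind eta function `η(τ) = q^{1/24} ∏_{m≥1} (1 − qᵐ)`, `q = e^{2πiτ}`. -/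
noncomputable def dedekindEta (τ : ℂ) : ℂ :=
  Complex.exp (Real.pi * Complex.I * τ / 12) *
    ∏' m : ℕ, (1 - Complex.exp (2 * Real.pi * Complex.I * (m + 1) * τ))

/-- The polynomial `fₙ(x) = 1 + x + ⋯ + xⁿ`. -/
noncomputable def fgeom (n : ℕ) (x : ℂ) : ℂ := ∑ k ∈ Finset.range (n + 1), x ^ k

/-- The finite `q`-factorial product `∏_{m=1}^N (1 - q^m)`. -/
noncomputable def qPoch (q : ℂ) (N : ℕ) : ℂ := ∏ m ∈ Finset.range N, (1 - q ^ (m + 1))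

/-- The Gaussian binomial coefficients, defined by the `q`-Pascal recursion. -/
noncomputable def qBinom (q : ℂ) : ℕ → ℕ → ℂ
  | _, 0 => 1
  | 0, _ + 1 => 0
  | M + 1, j + 1 => q ^ (j + 1) * qBinom q M (j + 1) + qBinom q M j

lemma qBinom_zero_right (q : ℂ) (M : ℕ) : qBinom q M 0 = 1 := by
  cases M <;> rfl

lemma qBinom_succ_succ (q : ℂ) (M j : ℕ) :
    qBinom q (M + 1) (j + 1) = q ^ (j + 1) * qBinom q M (j + 1) + qBinom q M j := rfl

lemma qBinom_eq_zero (q : ℂ) {M j : ℕ} (h : M < j) : qBinom q M j = 0 := by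
  induction M generalizing j with
  | zero => obtain ⟨j, rfl⟩ := Nat.exists_eq_succ_of_ne_zero h.ne'; rfl
  | succ M ih =>
    obtain ⟨j, rfl⟩ := Nat.exists_eq_succ_of_ne_zero (by lia : j ≠ 0)
    rw [Nat.succ_eq_add_one, qBinom_succ_succ, ih (by lia), ih (by lia)]
    simp

lemma qBinom_self (q : ℂ) (M : ℕ) : qBinom q M M = 1 := by
  induction M with
  | zero => rfl
  | succ M ih => rw [qBinom_succ_succ, qBinom_eq_zero q M.lt_succ_self, ih]; simp

lemma qPoch_succ (q : ℂ) (N : ℕ) : qPoch q (N + 1) = qPoch q N * (1 - q ^ (N + 1)) :=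
  Finset.prod_range_succ _ _

lemma qBinom_mul_qPoch (q : ℂ) (a b : ℕ) :
    qBinom q (a + b) a * qPoch q a * qPoch q b = qPoch q (a + b) := by
  induction h : a + b generalizing a b with
  | zero =>
    obtain ⟨rfl, rfl⟩ : a = 0 ∧ b = 0 := by lia
    simp [qPoch, qBinom_zero_right]
  | succ M ih =>
    rcases a with _ | a
    · obtain rfl : b = M + 1 := by lia
      simp [qBinom_zero_right, qPoch]
    rcases b with _ | b
    · obtain rfl : a = M := by lia
      simp [qBinom_self, qPoch]
    have h₁ := ih (a + 1) b (by lia)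
    have h₂ := ih a (b + 1) (by lia)
    obtain rfl : M = a + b + 1 := by lia
    rw [qBinom_succ_succ, qPoch_succ q (a + b + 1)]
    calc _ = q ^ (a + 1) * (1 - q ^ (b + 1)) *
            (qBinom q (a + b + 1) (a + 1) * qPoch q (a + 1) * qPoch q b) +
          (1 - q ^ (a + 1)) * (qBinom q (a + b + 1) a * qPoch q a * qPoch q (b + 1)) := by
            rw [qPoch_succ q a, qPoch_succ q b]; ring
      _ = _ := by rw [h₁, h₂]; ring

/-- The finite `q`-binomial theorem. -/
lemma prod_one_add_mul_pow (q x : ℂ) (M : ℕ) :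
    ∏ i ∈ Finset.range M, (1 + x * q ^ i) =
      ∑ j ∈ Finset.range (M + 1), qBinom q M j * (q ^ j.choose 2 * x ^ j) := by
  induction M generalizing x with
  | zero => simp [qBinom_zero_right]
  | succ M ih =>
    have hshift : ∏ i ∈ Finset.range M, (1 + x * q ^ (i + 1)) =
        ∏ i ∈ Finset.range M, (1 + x * q * q ^ i) :=
      Finset.prod_congr rfl fun i _ ↦ by ring
    have hlast : ∑ j ∈ Finset.range (M + 1), qBinom q M j * (q ^ j.choose 2 * (x * q) ^ j) =
        ∑ j ∈ Finset.range (M + 1),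
          q ^ (j + 1) * qBinom q M (j + 1) * (q ^ (j + 1).choose 2 * x ^ (j + 1)) + 1 := by
      have := Finset.sum_range_succ (fun j ↦ qBinom q M j * (q ^ j.choose 2 * (x * q) ^ j)) (M + 1)
      rw [qBinom_eq_zero q M.lt_succ_self, zero_mul, add_zero] at this
      rw [← this, Finset.sum_range_succ']
      congr 1
      · exact Finset.sum_congr rfl fun j _ ↦ by ring
      · simp [qBinom_zero_right]
    rw [Finset.prod_range_succ', hshift, ih, Finset.sum_range_succ' _ (M + 1), pow_zero, mul_one,
      mul_add, mul_one, Finset.sum_mul]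
    nth_rw 1 [hlast]
    rw [add_right_comm, ← Finset.sum_add_distrib]
    congr 1
    · refine Finset.sum_congr rfl fun j _ ↦ ?_
      rw [qBinom_succ_succ, Nat.choose_succ_succ' j 1, Nat.choose_one_right]
      ring
    · simp [qBinom_zero_right]

open Filter Topology

lemma one_sub_pow_succ_ne_zero {q : ℂ} (hq : ‖q‖ < 1) (m : ℕ) : 1 - q ^ (m + 1) ≠ 0 := by
  intro h
  have h₁ : ‖q ^ (m + 1)‖ < 1 := by
    rw [norm_pow]; exact pow_lt_one₀ (norm_nonneg _) hq m.succ_ne_zero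
  rw [← sub_eq_zero.mp h, norm_one] at h₁
  exact h₁.false

lemma qPoch_ne_zero {q : ℂ} (hq : ‖q‖ < 1) (N : ℕ) : qPoch q N ≠ 0 :=
  Finset.prod_ne_zero_iff.mpr fun m _ ↦ one_sub_pow_succ_ne_zero hq m

lemma tendsto_qPoch {q : ℂ} (hq : ‖q‖ < 1) :
    Tendsto (qPoch q) atTop (𝓝 (∏' m : ℕ, (1 - q ^ (m + 1)))) :=
  (ModularForm.multipliable_one_sub_pow hq).tendsto_prod_tprod_nat

lemma tprod_one_sub_pow_ne_zero {q : ℂ} (hq : ‖q‖ < 1) : ∏' m : ℕ, (1 - q ^ (m + 1)) ≠ 0 := by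
  simp_rw [sub_eq_add_neg]
  refine tprod_one_add_ne_zero_of_summable (f := fun m : ℕ ↦ -q ^ (m + 1)) (fun m ↦ ?_) ?_
  · simpa [← sub_eq_add_neg] using one_sub_pow_succ_ne_zero hq m
  · simpa using (summable_nat_add_iff 1).mpr (summable_geometric_of_lt_one (norm_nonneg _) hq)

lemma qBinom_eq_div {q : ℂ} (hq : ‖q‖ < 1) (a b : ℕ) :
    qBinom q (a + b) a = qPoch q (a + b) * (qPoch q a)⁻¹ * (qPoch q b)⁻¹ := by
  have ha := qPoch_ne_zero hq a
  have hb := qPoch_ne_zero hq b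
  rw [← qBinom_mul_qPoch q a b]
  field_simp

lemma exists_norm_qBinom_le {q : ℂ} (hq : ‖q‖ < 1) : ∃ C, ∀ M j, ‖qBinom q M j‖ ≤ C := by
  obtain ⟨C₁, hC₁⟩ := (tendsto_qPoch hq).norm.bddAbove_range
  obtain ⟨C₂, hC₂⟩ := ((tendsto_qPoch hq).inv₀ (tprod_one_sub_pow_ne_zero hq)).norm.bddAbove_range
  replace hC₁ N : ‖qPoch q N‖ ≤ C₁ := hC₁ ⟨N, rfl⟩
  replace hC₂ N : ‖(qPoch q N)⁻¹‖ ≤ C₂ := hC₂ ⟨N, rfl⟩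
  have h₁ : 0 ≤ C₁ := (norm_nonneg _).trans (hC₁ 0)
  have h₂ : 0 ≤ C₂ := (norm_nonneg _).trans (hC₂ 0)
  refine ⟨C₁ * C₂ * C₂, fun M j ↦ ?_⟩
  rcases lt_or_ge M j with h | h
  · rw [qBinom_eq_zero q h, norm_zero]
    positivity
  · obtain ⟨b, rfl⟩ := Nat.exists_eq_add_of_le h
    rw [qBinom_eq_div hq, norm_mul, norm_mul]
    gcongr
    exacts [hC₁ _, hC₂ _, hC₂ _]

lemma tendsto_qBinom_central {q : ℂ} (hq : ‖q‖ < 1) (k : ℤ) :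
    Tendsto (fun N : ℕ ↦ qBinom q (2 * N) (N - k).toNat) atTop
      (𝓝 (∏' m : ℕ, (1 - q ^ (m + 1)))⁻¹) := by
  have hP := tendsto_qPoch hq
  have hL := tprod_one_sub_pow_ne_zero hq
  have h₀ : Tendsto (fun N : ℕ ↦ 2 * N) atTop atTop :=
    tendsto_atTop_mono (fun N ↦ show N ≤ 2 * N by lia) tendsto_id
  have h₁ : Tendsto (fun N : ℕ ↦ ((N : ℤ) - k).toNat) atTop atTop :=
    tendsto_atTop.mpr fun b ↦ (eventually_ge_atTop (b + k.natAbs)).mono fun N hN ↦ by lia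
  have h₂ : Tendsto (fun N : ℕ ↦ ((N : ℤ) + k).toNat) atTop atTop :=
    tendsto_atTop.mpr fun b ↦ (eventually_ge_atTop (b + k.natAbs)).mono fun N hN ↦ by lia
  have := ((hP.comp h₀).mul ((hP.comp h₁).inv₀ hL)).mul ((hP.comp h₂).inv₀ hL)
  rw [mul_inv_cancel₀ hL, one_mul] at this
  refine this.congr' ?_
  filter_upwards [eventually_ge_atTop k.natAbs] with N hN
  have := qBinom_eq_div hq ((N : ℤ) - k).toNat ((N : ℤ) + k).toNat
  rw [show ((N : ℤ) - k).toNat + ((N : ℤ) + k).toNat = 2 * N by lia] at this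
  exact this.symm

lemma norm_cexp_lt_one {τ : ℂ} (hτ : 0 < τ.im) : ‖Complex.exp (2 * Real.pi * I * τ)‖ < 1 := by
  simpa using UpperHalfPlane.norm_exp_two_pi_I_lt_one ⟨τ, hτ⟩

lemma cexp_mul_add (τ z : ℂ) (m : ℕ) :
    Complex.exp (2 * Real.pi * I * (m * τ + z)) =
      Complex.exp (2 * Real.pi * I * τ) ^ m * Complex.exp (2 * Real.pi * I * z) := by
  rw [← Complex.exp_nat_mul, ← Complex.exp_add]
  ring_nf

lemma multipliable_one_sub_cexp {τ : ℂ} (hτ : 0 < τ.im) (z : ℂ) :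
    Multipliable fun m : ℕ ↦ 1 - Complex.exp (2 * Real.pi * I * (m * τ + z)) := by
  simp_rw [cexp_mul_add, sub_eq_add_neg]
  refine multipliable_one_add_of_summable ?_
  simpa using (summable_geometric_of_lt_one (norm_nonneg _) (norm_cexp_lt_one hτ)).mul_right _

lemma jacobiTheta₂_term_shift_succ (τ z : ℂ) (k : ℤ) :
    jacobiTheta₂_term (k + 1) (z + 1 / 2 + τ / 2) τ =
      jacobiTheta₂_term k (z + 1 / 2 + τ / 2) τ * -Complex.exp (2 * Real.pi * I * ((k + 1) * τ + z)) := by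
  rw [← neg_one_mul, ← Complex.exp_pi_mul_I, jacobiTheta₂_term, jacobiTheta₂_term,
    ← Complex.exp_add, ← Complex.exp_add]
  push_cast
  ring_nf

/-- The finite form of the Jacobi triple product. -/
lemma finite_jacobi_triple_product (τ z : ℂ) (N : ℕ) :
    (∏ m ∈ Finset.range N, (1 - Complex.exp (2 * Real.pi * I * ((m + 1) * τ + z)))) *
      ∏ m ∈ Finset.range N, (1 - Complex.exp (2 * Real.pi * I * (m * τ - z))) =
    ∑ j ∈ Finset.range (2 * N + 1), qBinom (Complex.exp (2 * Real.pi * I * τ)) (2 * N) j *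
      jacobiTheta₂_term (N - j) (z + 1 / 2 + τ / 2) τ := by
  set q := Complex.exp (2 * Real.pi * I * τ) with hq
  set c : ℤ → ℂ := fun k ↦ jacobiTheta₂_term k (z + 1 / 2 + τ / 2) τ with hc
  have hstep (k : ℤ) : c (k + 1) = c k * -Complex.exp (2 * Real.pi * I * ((k + 1) * τ + z)) :=
    jacobiTheta₂_term_shift_succ τ z k
  set x := -Complex.exp (2 * Real.pi * I * (-N * τ - z)) with hx
  have hterm (i : ℕ) : x * q ^ i = -Complex.exp (2 * Real.pi * I * ((i - N) * τ - z)) := by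
    rw [hx, hq, ← Complex.exp_nat_mul, neg_mul, ← Complex.exp_add]
    ring_nf
  have hcN : ∏ m ∈ Finset.range N, -Complex.exp (2 * Real.pi * I * ((m + 1) * τ + z)) = c N := by
    clear_value q x
    clear hterm hx
    induction N with
    | zero => simp [hc, jacobiTheta₂_term]
    | succ N ih =>
      rw [Finset.prod_range_succ, ih]
      push_cast
      exact_mod_cast (hstep N).symm
  have hcj (j : ℕ) : c N * (q ^ j.choose 2 * x ^ j) = c (N - j) := by
    induction j with
    | zero => simp
    | succ j ih =>
      have h := hstep (N - (j + 1))
      rw [show (N : ℤ) - (j + 1) + 1 = N - j by ring] at h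
      rw [Nat.choose_succ_succ' j 1, Nat.choose_one_right]
      calc _ = c N * (q ^ j.choose 2 * x ^ j) * (x * q ^ j) := by ring
        _ = c (N - (j + 1)) * (Complex.exp (2 * Real.pi * I * ((N - j) * τ + z)) *
              Complex.exp (2 * Real.pi * I * ((j - N) * τ - z))) := by
            rw [ih, h, hterm]
            push_cast
            ring_nf
        _ = _ := by
            rw [← Complex.exp_add, (congrArg Complex.exp (by ring)).trans Complex.exp_zero, mul_one]
            push_cast
            rfl
  have hreflect : ∏ m ∈ Finset.range N, (1 - Complex.exp (2 * Real.pi * I * ((m + 1) * τ + z))) =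
      c N * ∏ i ∈ Finset.range N, (1 + x * q ^ i) := by
    rw [← hcN, ← Finset.prod_range_reflect (fun i ↦ 1 + x * q ^ i), ← Finset.prod_mul_distrib]
    refine Finset.prod_congr rfl fun m hm ↦ ?_
    have hm : m + 1 ≤ N := Finset.mem_range.mp hm
    have hinv : Complex.exp (2 * Real.pi * I * ((m + 1) * τ + z)) *
        Complex.exp (2 * Real.pi * I * ((((m + 1 : ℕ) : ℂ) * -1) * τ - z)) = 1 := by
      rw [← Complex.exp_add]
      exact (congrArg Complex.exp (by push_cast; ring)).trans Complex.exp_zero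
    rw [hterm, Nat.sub_sub, add_comm 1 m, Nat.cast_sub hm,
      show (N : ℂ) - (m + 1 : ℕ) - N = (m + 1 : ℕ) * -1 by ring]
    linear_combination -hinv
  have htail : ∏ m ∈ Finset.range N, (1 - Complex.exp (2 * Real.pi * I * (m * τ - z))) =
      ∏ i ∈ Finset.range N, (1 + x * q ^ (N + i)) := by
    refine Finset.prod_congr rfl fun i _ ↦ ?_
    rw [hterm]
    push_cast
    ring_nf
  rw [hreflect, htail, mul_assoc, ← Finset.prod_range_add, ← two_mul, prod_one_add_mul_pow,
    Finset.mul_sum]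
  exact Finset.sum_congr rfl fun j _ ↦ by
    rw [mul_left_comm, hcj]

/-- The Jacobi triple product. -/
lemma jacobi_triple_product {τ : ℂ} (hτ : 0 < τ.im) (z : ℂ) :
    jacobiTheta₂ (z + 1 / 2 + τ / 2) τ =
      (∏' m : ℕ, (1 - Complex.exp (2 * Real.pi * I * (m + 1) * τ))) *
        (∏' m : ℕ, (1 - Complex.exp (2 * Real.pi * I * ((m + 1) * τ + z)))) *
        ∏' m : ℕ, (1 - Complex.exp (2 * Real.pi * I * (m * τ - z))) := by
  set q := Complex.exp (2 * Real.pi * I * τ) with hq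
  have hq1 : ‖q‖ < 1 := norm_cexp_lt_one hτ
  obtain ⟨C, hC⟩ := exists_norm_qBinom_le hq1
  set c : ℤ → ℂ := fun k ↦ jacobiTheta₂_term k (z + 1 / 2 + τ / 2) τ with hc
  have hcs : Summable c := (summable_jacobiTheta₂_term_iff _ τ).mpr hτ
  let F (N : ℕ) (k : ℤ) : ℂ := if k ≤ N then qBinom q (2 * N) (N - k).toNat * c k else 0
  have hFlim : Tendsto (fun N ↦ ∑' k, F N k) atTop
      (𝓝 (∑' k, (∏' m : ℕ, (1 - q ^ (m + 1)))⁻¹ * c k)) := by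
    refine tendsto_tsum_of_dominated_convergence (hcs.norm.mul_left C) (fun k ↦ ?_)
      (.of_forall fun N k ↦ ?_)
    · refine ((tendsto_qBinom_central hq1 k).mul_const (c k)).congr' ?_
      filter_upwards [eventually_ge_atTop k.natAbs] with N hN
      exact (if_pos (by lia)).symm
    · by_cases h : k ≤ N
      · simp only [F, if_pos h, norm_mul]
        gcongr
        exact hC _ _
      · simp only [F, if_neg h, norm_zero]
        exact mul_nonneg ((norm_nonneg _).trans (hC 0 0)) (norm_nonneg _)
  have hF (N : ℕ) : ∑' k, F N k =
      (∏ m ∈ Finset.range N, (1 - Complex.exp (2 * Real.pi * I * ((m + 1) * τ + z)))) *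
        ∏ m ∈ Finset.range N, (1 - Complex.exp (2 * Real.pi * I * (m * τ - z))) := by
    have hinj : Function.Injective fun j : ℕ ↦ (N : ℤ) - j := fun a b h ↦ by
      simpa using h
    rw [finite_jacobi_triple_product, tsum_eq_sum (s := (Finset.range (2 * N + 1)).map ⟨_, hinj⟩),
      Finset.sum_map]
    · refine Finset.sum_congr rfl fun j _ ↦ ?_
      simp [F, hc, hq]
    · intro k hk
      by_cases h : k ≤ N
      · have : 2 * N < (N - k).toNat := by
          by_contra! hlt
          refine hk (Finset.mem_map.mpr ⟨(N - k).toNat, Finset.mem_range.mpr (by lia), ?_⟩)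
          simp only [Function.Embedding.coeFn_mk]
          lia
        simp only [F, if_pos h, qBinom_eq_zero q this, zero_mul]
      · exact if_neg h
  have hA : Multipliable fun m : ℕ ↦ 1 - Complex.exp (2 * Real.pi * I * ((m + 1) * τ + z)) :=
    (multipliable_one_sub_cexp hτ (τ + z)).congr fun m ↦ by ring_nf
  have hB : Multipliable fun m : ℕ ↦ 1 - Complex.exp (2 * Real.pi * I * (m * τ - z)) :=
    (multipliable_one_sub_cexp hτ (-z)).congr fun m ↦ by ring_nf
  have hprod := hA.tendsto_prod_tprod_nat.mul hB.tendsto_prod_tprod_nat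
  have hlim := tendsto_nhds_unique (hFlim.congr hF) hprod
  have hL : ∏' m : ℕ, (1 - Complex.exp (2 * Real.pi * I * (m + 1) * τ)) =
      ∏' m : ℕ, (1 - q ^ (m + 1)) := by
    refine tprod_congr fun m ↦ ?_
    rw [hq, ← Complex.exp_nat_mul]
    push_cast
    ring_nf
  rw [hL, mul_assoc, ← hlim, tsum_mul_left, mul_inv_cancel_left₀ (tprod_one_sub_pow_ne_zero hq1)]
  rfl

lemma theta11_eq_mul_jacobiTheta₂ (τ z : ℂ) :
    theta11 τ z = I * Complex.exp (Real.pi * I * τ / 4) * Complex.exp (Real.pi * I * z) *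
      jacobiTheta₂ (z + 1 / 2 + τ / 2) τ := by
  rw [theta11, jacobiTheta₂, ← tsum_mul_left]
  refine tsum_congr fun k ↦ ?_
  conv_rhs => enter [1, 1, 1]; rw [← Complex.exp_pi_div_two_mul_I]
  rw [jacobiTheta₂_term, ← Complex.exp_add, ← Complex.exp_add, ← Complex.exp_add]
  ring_nf

lemma fgeom_eq_prod {n : ℕ} {ξ : ℂ} (hξ : IsPrimitiveRoot ξ (n + 1)) (x : ℂ) :
    fgeom n x = ∏ j ∈ Finset.Icc 1 n, (1 - ξ ^ j * x) := by
  have hIcc : ∏ j ∈ Finset.Icc 1 n, (1 - ξ ^ j * x) =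
      ∏ j ∈ Finset.range n, (1 - ξ ^ (j + 1) * x) := by
    rw [← Finset.Ico_add_one_right_eq_Icc, Finset.prod_Ico_eq_prod_range]
    simp [add_comm]
  rw [hIcc, fgeom]
  rcases eq_or_ne x 1 with rfl | hx
  · simpa using hξ.prod_one_sub_pow_eq_order.symm
  · have h := congrArg (Polynomial.eval 1) (X_pow_sub_C_eq_prod hξ n.succ_pos (α := x) rfl)
    rw [Finset.prod_range_succ'] at h
    simp only [Polynomial.eval_sub, Polynomial.eval_pow, Polynomial.eval_X, Polynomial.eval_C,
      Polynomial.eval_mul, Polynomial.eval_prod, one_pow, pow_zero, one_mul] at h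
    refine mul_right_cancel₀ (sub_ne_zero.mpr hx.symm) ?_
    rw [geom_sum_mul_neg, h]

lemma prod_cexp_pi_div (n : ℕ) :
    ∏ j ∈ Finset.Icc 1 n, Complex.exp (Real.pi * I * (j / (n + 1))) = I ^ n := by
  have hn : (n : ℂ) + 1 ≠ 0 := Nat.cast_add_one_ne_zero n
  have hsum : ∑ j ∈ Finset.Icc 1 n, (j : ℂ) = n * (n + 1) / 2 := by
    clear hn
    induction n with
    | zero => simp
    | succ n ih => rw [Finset.sum_Icc_succ_top (by lia), ih]; push_cast; ring
  rw [← Complex.exp_sum, ← Finset.mul_sum, ← Finset.sum_div, hsum]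
  conv_rhs => rw [← Complex.exp_pi_div_two_mul_I, ← Complex.exp_nat_mul]
  congr 1
  field_simp

/-- **The eta–theta form of the width-`n` Euler-characteristic flop error term:**
`q^{n/12} t^{n/2} ∏_{m>0} fₙ(qᵐ t) ∏_{m≥0} fₙ(qᵐ t⁻¹)
  = ∏_{j=1}^{n} { −η(q)⁻¹ ϑ_{1,1}(q, ξʲ t) }`, `ξ = e^{2πi/(n+1)}`,
cleared of denominators: with `q = e^{2πiτ}`, `t = e^{2πiz}`,
`η(τ)ⁿ e^{πinτ/6} e^{πinz} ∏_{m≥1} fₙ(e^{2πi(mτ+z)}) ∏_{m≥0} fₙ(e^{2πi(mτ−z)})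
  = ∏_{j=1}^{n} (−ϑ₁₁(τ, z + j/(n+1)))`, the infinite products being multipliable. -/
theorem flop_error_term_eta_theta (n : ℕ) (hn : 1 ≤ n) (τ z : ℂ) (hτ : 0 < τ.im) :
    (Multipliable fun m : ℕ =>
      fgeom n (Complex.exp (2 * Real.pi * Complex.I * (((m : ℂ) + 1) * τ + z)))) ∧
    (Multipliable fun m : ℕ =>
      fgeom n (Complex.exp (2 * Real.pi * Complex.I * ((m : ℂ) * τ - z)))) ∧
    dedekindEta τ ^ n * Complex.exp (Real.pi * Complex.I * n * τ / 6) *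
        Complex.exp (Real.pi * Complex.I * n * z) *
        (∏' m : ℕ, fgeom n (Complex.exp (2 * Real.pi * Complex.I * (((m : ℂ) + 1) * τ + z)))) *
        (∏' m : ℕ, fgeom n (Complex.exp (2 * Real.pi * Complex.I * ((m : ℂ) * τ - z)))) =
      ∏ j ∈ Finset.Icc 1 n, (-(theta11 τ (z + j / (n + 1)))) := by
  have hξ : IsPrimitiveRoot (Complex.exp (2 * Real.pi * I / (n + 1 : ℕ))) (n + 1) :=
    Complex.isPrimitiveRoot_exp _ n.succ_ne_zero
  have hfA (m : ℕ) : fgeom n (Complex.exp (2 * Real.pi * I * ((m + 1) * τ + z))) =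
      ∏ j ∈ Finset.Icc 1 n,
        (1 - Complex.exp (2 * Real.pi * I * ((m + 1) * τ + (z + j / (n + 1))))) := by
    rw [fgeom_eq_prod hξ]
    refine Finset.prod_congr rfl fun j _ ↦ ?_
    rw [← Complex.exp_nat_mul, ← Complex.exp_add]
    push_cast
    ring_nf
  have hfB (m : ℕ) : fgeom n (Complex.exp (2 * Real.pi * I * (m * τ - z))) =
      ∏ j ∈ Finset.Icc 1 n,
        (1 - Complex.exp (2 * Real.pi * I * (m * τ - (z + j / (n + 1))))) := by
    rw [fgeom_eq_prod hξ.inv]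
    refine Finset.prod_congr rfl fun j _ ↦ ?_
    rw [← Complex.exp_neg, ← Complex.exp_nat_mul, ← Complex.exp_add]
    push_cast
    ring_nf
  have hA (w : ℂ) : Multipliable fun m : ℕ ↦ 1 - Complex.exp (2 * Real.pi * I * ((m + 1) * τ + w)) :=
    (multipliable_one_sub_cexp hτ (τ + w)).congr fun m ↦ by ring_nf
  have hB (w : ℂ) : Multipliable fun m : ℕ ↦ 1 - Complex.exp (2 * Real.pi * I * (m * τ - w)) :=
    (multipliable_one_sub_cexp hτ (-w)).congr fun m ↦ by ring_nf
  simp_rw [hfA, hfB]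
  refine ⟨multipliable_prod fun j _ ↦ hA _, multipliable_prod fun j _ ↦ hB _, ?_⟩
  rw [Multipliable.tprod_finsetProd fun j _ ↦ hA _, Multipliable.tprod_finsetProd fun j _ ↦ hB _]
  have hθ (j : ℕ) : -theta11 τ (z + j / (n + 1)) =
      -I * Complex.exp (Real.pi * I * τ / 4) * Complex.exp (Real.pi * I * z) *
        (∏' m : ℕ, (1 - Complex.exp (2 * Real.pi * I * (m + 1) * τ))) *
        Complex.exp (Real.pi * I * (j / (n + 1))) *
        (∏' m : ℕ, (1 - Complex.exp (2 * Real.pi * I * ((m + 1) * τ + (z + j / (n + 1)))))) *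
        ∏' m : ℕ, (1 - Complex.exp (2 * Real.pi * I * (m * τ - (z + j / (n + 1))))) := by
    rw [theta11_eq_mul_jacobiTheta₂, jacobi_triple_product hτ, mul_add, Complex.exp_add]
    ring
  simp_rw [hθ, Finset.prod_mul_distrib, Finset.prod_const, prod_cexp_pi_div, Nat.card_Icc,
    Nat.add_sub_cancel, dedekindEta, mul_pow]
  have hI : (-I) ^ n * I ^ n = 1 := by rw [← mul_pow]; simp
  have hτ' : Complex.exp (Real.pi * I * τ / 12) ^ n * Complex.exp (Real.pi * I * n * τ / 6) =
      Complex.exp (Real.pi * I * τ / 4) ^ n := by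
    rw [← Complex.exp_nat_mul, ← Complex.exp_nat_mul, ← Complex.exp_add]
    ring_nf
  have hz : Complex.exp (Real.pi * I * n * z) = Complex.exp (Real.pi * I * z) ^ n := by
    rw [← Complex.exp_nat_mul]
    ring_nf
  rw [hz, ← hτ']
  refine (mul_one _).symm.trans ?_
  rw [← hI]
  ring
end
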